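/- arXiv:1405.4270 — 2 statements merged into one kernel-verified Lean document; each statement's English description precedes it below -/
import Mathlib

section
/- Fix a real α with 0 < α ≤ 1, positive integers p, q with p + q = n, and positive reals λ₁, λ₂, θ₁, θ₂ such that the vector consisting of p copies of λ₁ followed by q copies of λ₂ is majorized by the vector of p copies of θ₁ followed by q copies of θ₂. Then the lifetime of the multiple-outlier parallel system with scale parameters (λ₁ repeated p times, λ₂ repeated q times) is smaller in the likelihood ratio order than the one with scale parameters (θ₁ repeated p times, θ₂ repeated q times); that is, the ratio of densities f_{n:n}^θ(t) / f_{n:n}^λ(t) is increasing in t on (0, ∞). -/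
open Real Set

/-- `x` is weakly majorized (from below) by `y`: for every `j`, the sum of the `j`
smallest components of `x` is at least the sum of the `j` smallest components of `y`.
Equivalently: for every subset `s` of indices there is a subset `u` of the same
cardinality with `∑_{i ∈ u} y i ≤ ∑_{i ∈ s} x i`. -/
def WeaklyMajorizedBy {n : ℕ} (x y : Fin n → ℝ) : Prop :=
  ∀ s : Finset (Fin n), ∃ u : Finset (Fin n),
    u.card = s.card ∧ ∑ i ∈ u, y i ≤ ∑ i ∈ s, x i

/-- `x` is majorized by `y`: the partial sums of the `j` smallest components of `x`
dominate those of `y`, and the total sums agree. -/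
def MajorizedBy {n : ℕ} (x y : Fin n → ℝ) : Prop :=
  WeaklyMajorizedBy x y ∧ ∑ i, x i = ∑ i, y i

/-- The function `w ↦ w / (e ^ w - 1)`. -/
noncomputable def expRatio (w : ℝ) : ℝ := w / (exp w - 1)

/-- The Todd function `w ↦ w e ^ w / (e ^ w - 1)`, written as `w + w / (e ^ w - 1)`. -/
noncomputable def toddFun (w : ℝ) : ℝ := w + expRatio w

/-- The derivative of `toddFun`. -/
noncomputable def toddDeriv (w : ℝ) : ℝ := exp w * (exp w - 1 - w) / (exp w - 1) ^ 2

lemma monotoneOn_Ioi_of_hasDerivAt {a : ℝ} {f f' : ℝ → ℝ}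
    (hf : ∀ x, a < x → HasDerivAt f (f' x) x) (hf' : ∀ x, a < x → 0 ≤ f' x) :
    MonotoneOn f (Ioi a) := by
  refine monotoneOn_of_deriv_nonneg (convex_Ioi a)
    (fun x hx => (hf x hx).continuousAt.continuousWithinAt) ?_ ?_
  · intro x hx
    rw [interior_Ioi] at hx
    exact (hf x hx).differentiableAt.differentiableWithinAt
  · intro x hx
    rw [interior_Ioi] at hx
    rw [(hf x hx).deriv]
    exact hf' x hx

lemma sub_le_sub_of_hasDerivAt_le {f g f' g' : ℝ → ℝ} {x y : ℝ} (hxy : x ≤ y)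
    (hf : ∀ z ∈ Icc x y, HasDerivAt f (f' z) z) (hg : ∀ z ∈ Icc x y, HasDerivAt g (g' z) z)
    (hle : ∀ z ∈ Icc x y, f' z ≤ g' z) : f y - f x ≤ g y - g x := by
  have hd : ∀ z ∈ Icc x y, HasDerivAt (fun z => g z - f z) (g' z - f' z) z :=
    fun z hz => (hg z hz).sub (hf z hz)
  have hmono : MonotoneOn (fun z => g z - f z) (Icc x y) := by
    refine monotoneOn_of_deriv_nonneg (convex_Icc x y)
      (fun z hz => (hd z hz).continuousAt.continuousWithinAt) ?_ ?_
    · exact fun z hz => (hd z (interior_subset hz)).differentiableAt.differentiableWithinAt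
    · intro z hz
      rw [(hd z (interior_subset hz)).deriv]
      exact sub_nonneg.2 (hle z (interior_subset hz))
  have := hmono (left_mem_Icc.2 hxy) (right_mem_Icc.2 hxy) hxy
  dsimp only at this
  linarith

/-- A function with antitone derivative lies below its tangents. -/
lemma le_tangent_of_antitoneOn_deriv {f f' : ℝ → ℝ}
    (hf : ∀ x, 0 < x → HasDerivAt f (f' x) x) (hf' : AntitoneOn f' (Ioi 0))
    {x y : ℝ} (hx : 0 < x) (hy : 0 < y) : f y ≤ f x + f' x * (y - x) := by
  have hlin : ∀ z, HasDerivAt (fun z => f' x * z) (f' x) z := fun z => by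
    simpa using (hasDerivAt_id z).const_mul (f' x)
  rcases le_total x y with h | h
  · have := sub_le_sub_of_hasDerivAt_le h (fun z hz => hf z (hx.trans_le hz.1))
      (fun z _ => hlin z) (fun z hz => hf' hx (hx.trans_le hz.1) hz.1)
    linarith
  · have := sub_le_sub_of_hasDerivAt_le h (fun z _ => hlin z)
      (fun z hz => hf z (hy.trans_le hz.1)) (fun z hz => hf' (hy.trans_le hz.1) hx hz.2)
    linarith

/-- Comparison of the weighted sums of `f` at two pairs of points, the second pair being more
spread out, when `f` lies below lines of slopes `s₂ ≤ s₁` outside of the first pair. -/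
lemma weighted_sum_le_of_slopes {f : ℝ → ℝ} {p q x₁ x₂ y₁ y₂ s₁ s₂ : ℝ}
    (hp : 0 ≤ p) (hq : 0 ≤ q) (hlo : min y₁ y₂ ≤ x₁) (hhi : x₂ ≤ max y₁ y₂)
    (hy₁ : 0 < y₁) (hy₂ : 0 < y₂)
    (hsum : p * y₁ + q * y₂ ≤ p * x₁ + q * x₂) (hs₂ : 0 ≤ s₂) (hs : s₂ ≤ s₁)
    (hleft : ∀ y, 0 < y → y ≤ x₁ → f y ≤ f x₁ + s₁ * (y - x₁))
    (hright : ∀ y, x₂ ≤ y → f y ≤ f x₂ + s₂ * (y - x₂))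
    (hpq : p ≤ q → f x₁ ≤ f x₂ + s₂ * (x₁ - x₂))
    (hqp : q ≤ p → f x₂ ≤ f x₁ + s₁ * (x₂ - x₁)) :
    p * f y₁ + q * f y₂ ≤ p * f x₁ + q * f x₂ := by
  rcases le_total y₁ y₂ with h | h
  · rw [min_eq_left h] at hlo
    rw [max_eq_right h] at hhi
    have e₁ := mul_le_mul_of_nonneg_left (hleft y₁ hy₁ hlo) hp
    have e₂ := mul_le_mul_of_nonneg_left (hright y₂ hhi) hq
    have e₃ := mul_nonneg (mul_nonneg hp (sub_nonneg.2 hs)) (sub_nonneg.2 hlo)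
    have e₄ := mul_nonneg hs₂ (sub_nonneg.2 hsum)
    linarith
  · rw [min_eq_right h] at hlo
    rw [max_eq_left h] at hhi
    have e₁ := mul_le_mul_of_nonneg_left (hleft y₂ hy₂ hlo) hq
    have e₂ := mul_le_mul_of_nonneg_left (hright y₁ hhi) hp
    rcases le_total p q with hle | hle
    · have e₃ := mul_nonneg (mul_nonneg hq (sub_nonneg.2 hs)) (sub_nonneg.2 hlo)
      have e₄ := mul_nonneg hs₂ (sub_nonneg.2 hsum)
      have e₅ := mul_le_mul_of_nonneg_left (hpq hle) (sub_nonneg.2 hle)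
      linarith
    · have e₃ := mul_nonneg (mul_nonneg hp (sub_nonneg.2 hs)) (sub_nonneg.2 hhi)
      have e₄ := mul_nonneg (hs₂.trans hs) (sub_nonneg.2 hsum)
      have e₅ := mul_le_mul_of_nonneg_left (hqp hle) (sub_nonneg.2 hle)
      linarith

/-- The case of `weighted_sum_le_of_slopes` where `f` is nondecreasing with antitone derivative. -/
lemma weighted_sum_le_of_antitoneOn_deriv {f f' : ℝ → ℝ} {p q x₁ x₂ y₁ y₂ : ℝ}
    (hf : ∀ x, 0 < x → HasDerivAt f (f' x) x) (hf' : AntitoneOn f' (Ioi 0))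
    (hf₀ : ∀ x, 0 < x → 0 ≤ f' x) (hp : 0 ≤ p) (hq : 0 ≤ q) (hx₁ : 0 < x₁) (hx : x₁ ≤ x₂)
    (hlo : min y₁ y₂ ≤ x₁) (hhi : x₂ ≤ max y₁ y₂) (hy₁ : 0 < y₁) (hy₂ : 0 < y₂)
    (hsum : p * y₁ + q * y₂ ≤ p * x₁ + q * x₂) :
    p * f y₁ + q * f y₂ ≤ p * f x₁ + q * f x₂ := by
  have hx₂ := hx₁.trans_le hx
  exact weighted_sum_le_of_slopes hp hq hlo hhi hy₁ hy₂ hsum (hf₀ _ hx₂) (hf' hx₁ hx₂ hx)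
    (fun y hy _ => le_tangent_of_antitoneOn_deriv hf hf' hx₁ hy)
    (fun y hy => le_tangent_of_antitoneOn_deriv hf hf' hx₂ (hx₂.trans_le hy))
    (fun _ => le_tangent_of_antitoneOn_deriv hf hf' hx₂ hx₁)
    (fun _ => le_tangent_of_antitoneOn_deriv hf hf' hx₁ hx₂)

lemma exp_sub_one_pos {w : ℝ} (hw : 0 < w) : 0 < exp w - 1 := by
  linarith [add_one_lt_exp hw.ne']

lemma expRatio_pos {w : ℝ} (hw : 0 < w) : 0 < expRatio w := div_pos hw (exp_sub_one_pos hw)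

lemma hasDerivAt_expRatio {w : ℝ} (hw : 0 < w) :
    HasDerivAt expRatio (toddDeriv w - 1) w := by
  have hE := (exp_sub_one_pos hw).ne'
  refine ((hasDerivAt_id w).div ((hasDerivAt_exp w).sub_const 1) hE).congr_deriv ?_
  simp only [toddDeriv, id]
  field_simp
  ring

lemma hasDerivAt_toddFun {w : ℝ} (hw : 0 < w) : HasDerivAt toddFun (toddDeriv w) w :=
  ((hasDerivAt_id w).add (hasDerivAt_expRatio hw)).congr_deriv (by ring)

lemma toddDeriv_pos {w : ℝ} (hw : 0 < w) : 0 < toddDeriv w :=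
  div_pos (mul_pos (exp_pos w) (by linarith [add_one_lt_exp hw.ne']))
    (pow_pos (exp_sub_one_pos hw) 2)

lemma toddDeriv_le_one {w : ℝ} (hw : 0 < w) : toddDeriv w ≤ 1 := by
  rw [toddDeriv, div_le_one (pow_pos (exp_sub_one_pos hw) 2)]
  have h := mul_le_mul_of_nonneg_left (add_one_le_exp (-w)) (exp_pos w).le
  rw [← exp_add, add_neg_cancel, exp_zero] at h
  nlinarith

lemma hasDerivAt_toddDeriv {w : ℝ} (hw : 0 < w) :
    HasDerivAt toddDeriv
      (exp w * ((w - 2) * (exp w - 1) + 2 * w) / (exp w - 1) ^ 3) w := by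
  have hE := (exp_sub_one_pos hw).ne'
  have h₁ : HasDerivAt (fun w => exp w * (exp w - 1 - w))
      (exp w * (exp w - 1 - w) + exp w * (exp w - 1)) w :=
    (hasDerivAt_exp w).mul (((hasDerivAt_exp w).sub_const 1).sub (hasDerivAt_id w))
  have h₂ : HasDerivAt (fun w => (exp w - 1) ^ 2) (2 * (exp w - 1) * exp w) w := by
    exact (((hasDerivAt_exp w).sub_const 1).pow 2).congr_deriv (by simp)
  refine (h₁.div h₂ (pow_ne_zero 2 hE)).congr_deriv ?_
  field_simp
  ring

lemma nonneg_of_deriv_nonneg_of_zero {f f' : ℝ → ℝ} (hf : ∀ x, HasDerivAt f (f' x) x)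
    (h₀ : f 0 = 0) {w : ℝ} (hw : 0 ≤ w) (hf' : ∀ x, 0 ≤ x → 0 ≤ f' x) : 0 ≤ f w := by
  have := sub_le_sub_of_hasDerivAt_le hw (fun z _ => hasDerivAt_const z (0 : ℝ))
    (fun z _ => hf z) (fun z hz => hf' z hz.1)
  linarith

lemma toddDeriv_numerator_nonneg {w : ℝ} (hw : 0 ≤ w) :
    0 ≤ (w - 2) * (exp w - 1) + 2 * w := by
  refine nonneg_of_deriv_nonneg_of_zero (f := fun w => (w - 2) * (exp w - 1) + 2 * w)
    (f' := fun w => (w - 1) * exp w + 1) (fun x => ?_) (by simp) hw (fun x _ => ?_)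
  · refine ((((hasDerivAt_id x).sub_const 2).mul ((hasDerivAt_exp x).sub_const 1)).add
      ((hasDerivAt_id x).const_mul 2)).congr_deriv ?_
    simp only [id]
    ring
  · have h := mul_le_mul_of_nonneg_left (add_one_le_exp (-x)) (exp_pos x).le
    rw [← exp_add, add_neg_cancel, exp_zero] at h
    linarith

lemma monotoneOn_toddDeriv : MonotoneOn toddDeriv (Ioi 0) :=
  monotoneOn_Ioi_of_hasDerivAt (fun _ hw => hasDerivAt_toddDeriv hw) fun w hw =>
    div_nonneg (mul_nonneg (exp_pos w).le (toddDeriv_numerator_nonneg (le_of_lt hw)))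
      (pow_pos (exp_sub_one_pos hw) 3).le

lemma antitoneOn_expRatio : AntitoneOn expRatio (Ioi 0) := by
  have : MonotoneOn (fun w => -expRatio w) (Ioi 0) :=
    monotoneOn_Ioi_of_hasDerivAt (fun w hw => (hasDerivAt_expRatio hw).neg) fun w hw => by
      linarith [toddDeriv_le_one hw]
  exact fun x hx y hy h => neg_le_neg_iff.1 (this hx hy h)

lemma monotoneOn_toddFun : MonotoneOn toddFun (Ioi 0) :=
  monotoneOn_Ioi_of_hasDerivAt (fun _ hw => hasDerivAt_toddFun hw) fun _ hw =>
    (toddDeriv_pos hw).le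

lemma cubic_le_exp_sub_one {w : ℝ} (hw : 0 ≤ w) :
    w + w ^ 2 / 2 + w ^ 3 / 6 ≤ exp w - 1 := by
  have h := sum_le_exp_of_nonneg hw 4
  simp [Finset.sum_range_succ, Nat.factorial] at h
  linarith

lemma antitoneOn_toddDeriv_div : AntitoneOn (fun w => toddDeriv w / (w + 2)) (Ioi 0) := by
  have : MonotoneOn (fun w => -(toddDeriv w / (w + 2))) (Ioi 0) := by
    refine monotoneOn_Ioi_of_hasDerivAt (fun w hw => ((hasDerivAt_toddDeriv hw).div
      ((hasDerivAt_id w).add_const 2) (by simp only [id]; linarith)).neg) fun w hw => ?_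
    have hE := exp_sub_one_pos hw
    have hc := cubic_le_exp_sub_one hw.le
    simp only [id, toddDeriv, mul_one]
    rw [← neg_div]
    refine div_nonneg ?_ (by positivity)
    have key : 0 ≤ (exp w - 1) ^ 2 + (4 - w - w ^ 2) * (exp w - 1) - 2 * w ^ 2 - 4 * w := by
      have h₁ : 0 ≤ (exp w - 1 - (w + w ^ 2 / 2 + w ^ 3 / 6)) *
          (exp w - 1 + (w + w ^ 2 / 2 + w ^ 3 / 6) + 4 - w - w ^ 2) := by
        refine mul_nonneg (by linarith) ?_
        have : 0 < w ^ 3 := by positivity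
        linarith
      have h₂ : 0 ≤ w ^ 3 * (6 - 3 * w + w ^ 3) := by
        refine mul_nonneg (by positivity) ?_
        nlinarith [mul_nonneg hw.le (sq_nonneg (w - 1)), sq_nonneg (w - 1)]
      linarith
    have : -(exp w * ((w - 2) * (exp w - 1) + 2 * w) / (exp w - 1) ^ 3 * (w + 2) -
        exp w * (exp w - 1 - w) / (exp w - 1) ^ 2) = exp w *
        ((exp w - 1) ^ 2 + (4 - w - w ^ 2) * (exp w - 1) - 2 * w ^ 2 - 4 * w) /
          (exp w - 1) ^ 3 := by
      field_simp
      ring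
    rw [this]
    positivity
  exact fun x hx y hy h => neg_le_neg_iff.1 (this hx hy h)

lemma antitoneOn_add_two_mul_expRatio : AntitoneOn (fun w => (w + 2) * expRatio w) (Ioi 0) := by
  have : MonotoneOn (fun w => -((w + 2) * expRatio w)) (Ioi 0) := by
    refine monotoneOn_Ioi_of_hasDerivAt (fun w hw => (((hasDerivAt_id w).add_const 2).mul
      (hasDerivAt_expRatio hw)).neg) fun w hw => ?_
    have hE := exp_sub_one_pos hw
    have key : 0 ≤ (w ^ 2 - 2) * (exp w - 1) + w ^ 2 + 2 * w := by
      refine nonneg_of_deriv_nonneg_of_zero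
        (f := fun w => (w ^ 2 - 2) * (exp w - 1) + w ^ 2 + 2 * w)
        (f' := fun w => (w ^ 2 + 2 * w - 2) * exp w + 2) (fun x => ?_) (by simp) hw.le
        (fun x hx => ?_)
      · refine ((((((hasDerivAt_id x).pow 2).sub_const 2).mul
          ((hasDerivAt_exp x).sub_const 1)).add ((hasDerivAt_id x).pow 2)).add
          ((hasDerivAt_id x).const_mul 2)).congr_deriv ?_
        simp
        ring
      · refine nonneg_of_deriv_nonneg_of_zero
          (f := fun w => (w ^ 2 + 2 * w - 2) * exp w + 2)
          (f' := fun w => (w ^ 2 + 4 * w) * exp w) (fun x => ?_) (by simp) hx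
          (fun x hx => by positivity)
        refine ((((((hasDerivAt_id x).pow 2).add ((hasDerivAt_id x).const_mul 2)).sub_const 2).mul
          (hasDerivAt_exp x)).add_const 2).congr_deriv ?_
        simp
        ring
    have : -(1 * expRatio w + (id w + 2) * (toddDeriv w - 1)) =
        ((w ^ 2 - 2) * (exp w - 1) + w ^ 2 + 2 * w) / (exp w - 1) ^ 2 := by
      simp only [id, toddDeriv, expRatio]
      field_simp
      ring
    rw [this]
    positivity
  exact fun x hx y hy h => neg_le_neg_iff.1 (this hx hy h)

lemma hasDerivAt_const_mul_add_two_sq (c z : ℝ) :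
    HasDerivAt (fun z => c * ((z + 2) ^ 2 / 2)) (c * (z + 2)) z := by
  refine (((((hasDerivAt_id z).add_const 2).pow 2).div_const 2).const_mul c).congr_deriv ?_
  simp

lemma toddFun_sub_lower {x y : ℝ} (hx : 0 < x) (hxy : x ≤ y) :
    toddDeriv y * (y - x) * (expRatio x + expRatio y) ≤
      2 * (toddFun y - toddFun x) * expRatio x := by
  have hy := hx.trans_le hxy
  have h := sub_le_sub_of_hasDerivAt_le hxy
    (fun z _ => hasDerivAt_const_mul_add_two_sq (toddDeriv y / (y + 2)) z)
    (fun z hz => hasDerivAt_toddFun (hx.trans_le hz.1)) (fun z hz => by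
      have hz₀ := hx.trans_le hz.1
      have := antitoneOn_toddDeriv_div hz₀ hy hz.2
      rwa [le_div_iff₀ (by linarith)] at this)
  set c := toddDeriv y / (y + 2) with hc
  have hc₀ : 0 < c := div_pos (toddDeriv_pos hy) (by linarith)
  have hd : toddDeriv y = c * (y + 2) := by rw [hc]; field_simp
  have hv := antitoneOn_add_two_mul_expRatio hx hy hxy
  dsimp only at hv
  have e₁ := mul_le_mul_of_nonneg_right h (expRatio_pos hx).le
  have e₂ := mul_le_mul_of_nonneg_left hv (mul_nonneg hc₀.le (sub_nonneg.2 hxy))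
  rw [hd]
  linarith

lemma toddFun_sub_upper {x y : ℝ} (hx : 0 < x) (hxy : x ≤ y) :
    2 * (toddFun y - toddFun x) * expRatio y ≤
      toddDeriv x * (y - x) * (expRatio x + expRatio y) := by
  have hy := hx.trans_le hxy
  have h := sub_le_sub_of_hasDerivAt_le hxy
    (fun z hz => hasDerivAt_toddFun (hx.trans_le hz.1))
    (fun z _ => hasDerivAt_const_mul_add_two_sq (toddDeriv x / (x + 2)) z) (fun z hz => by
      have hz₀ := hx.trans_le hz.1
      have := antitoneOn_toddDeriv_div hx hz₀ hz.1
      rwa [div_le_iff₀ (by linarith)] at this)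
  set c := toddDeriv x / (x + 2) with hc
  have hc₀ : 0 < c := div_pos (toddDeriv_pos hx) (by linarith)
  have hd : toddDeriv x = c * (x + 2) := by rw [hc]; field_simp
  have hv := antitoneOn_add_two_mul_expRatio hx hy hxy
  dsimp only at hv
  have e₁ := mul_le_mul_of_nonneg_right h (expRatio_pos hy).le
  have e₂ := mul_le_mul_of_nonneg_left hv (mul_nonneg hc₀.le (sub_nonneg.2 hxy))
  rw [hd]
  linarith

lemma antitoneOn_expRatio_mul_toddDeriv :
    AntitoneOn (fun w => expRatio w * toddDeriv w) (Ioi 0) := by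
  intro x hx y hy hxy
  have hx' : 0 < x := hx
  have hy' : 0 < y := hy
  have h := mul_le_mul (antitoneOn_add_two_mul_expRatio hx hy hxy)
    (antitoneOn_toddDeriv_div hx hy hxy)
    (div_pos (toddDeriv_pos hy') (by linarith)).le
    (mul_pos (by linarith) (expRatio_pos hx')).le
  have e : ∀ z : ℝ, 0 < z → (z + 2) * expRatio z * (toddDeriv z / (z + 2)) =
      expRatio z * toddDeriv z := fun z hz => by field_simp
  dsimp only at h ⊢
  rwa [e x hx', e y hy'] at h

/-- The mean of `toddFun` at two points, weighted by multiples of `expRatio`. -/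
noncomputable def toddMean (p q x₁ x₂ : ℝ) : ℝ :=
  (p * (expRatio x₁ * toddFun x₁) + q * (expRatio x₂ * toddFun x₂)) /
    (p * expRatio x₁ + q * expRatio x₂)

lemma toddMean_le {p q x₁ x₂ y₁ y₂ : ℝ} (hp : 0 < p) (hq : 0 < q) (hx₁ : 0 < x₁)
    (hx : x₁ ≤ x₂) (hlo : min y₁ y₂ ≤ x₁) (hhi : x₂ ≤ max y₁ y₂) (hy₁ : 0 < y₁) (hy₂ : 0 < y₂)
    (hsum : p * y₁ + q * y₂ ≤ p * x₁ + q * x₂) :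
    toddMean p q y₁ y₂ ≤ toddMean p q x₁ x₂ := by
  have hx₂ := hx₁.trans_le hx
  have hv₁ := expRatio_pos hx₁
  have hv₂ := expRatio_pos hx₂
  have hv := antitoneOn_expRatio hx₁ hx₂ hx
  have hh := monotoneOn_toddFun hx₁ hx₂ hx
  have hA : 0 < p * expRatio x₁ + q * expRatio x₂ := by positivity
  set m := toddMean p q x₁ x₂ with hm
  have hmA : m * (p * expRatio x₁ + q * expRatio x₂) =
      p * (expRatio x₁ * toddFun x₁) + q * (expRatio x₂ * toddFun x₂) := by
    rw [hm, toddMean, div_mul_cancel₀ _ hA.ne']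
  have hm₁ : toddFun x₁ ≤ m := by
    rw [hm, toddMean, le_div_iff₀ hA]
    have := mul_le_mul_of_nonneg_left hh (mul_pos hq hv₂).le
    linarith
  have hm₂ : m ≤ toddFun x₂ := by
    rw [hm, toddMean, div_le_iff₀ hA]
    have := mul_le_mul_of_nonneg_left hh (mul_pos hp hv₁).le
    linarith
  have hdiff : (expRatio x₂ * (toddFun x₂ - m) - expRatio x₁ * (toddFun x₁ - m)) *
      (p * expRatio x₁ + q * expRatio x₂) =
      (p + q) * expRatio x₁ * expRatio x₂ * (toddFun x₂ - toddFun x₁) := by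
    linear_combination (expRatio x₁ - expRatio x₂) * hmA
  have hs₂ := mul_pos hv₂ (toddDeriv_pos hx₂)
  have key := weighted_sum_le_of_slopes (f := fun w => expRatio w * (toddFun w - m))
    hp.le hq.le hlo hhi hy₁ hy₂ hsum hs₂.le (antitoneOn_expRatio_mul_toddDeriv hx₁ hx₂ hx)
    ?_ ?_ ?_ ?_
  · rw [toddMean, div_le_iff₀ (by
      have := expRatio_pos hy₁
      have := expRatio_pos hy₂
      positivity)]
    linarith
  · intro y hy hyx
    have e₁ := toddFun_sub_lower hy hyx
    have hvy := antitoneOn_expRatio hy hx₁ hyx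
    have e₂ := mul_le_mul_of_nonneg_left hvy
      (mul_nonneg (toddDeriv_pos hx₁).le (sub_nonneg.2 hyx))
    have e₃ := mul_le_mul_of_nonneg_right hvy (sub_nonneg.2 hm₁)
    dsimp only
    linarith
  · intro y hxy
    have e₁ := toddFun_sub_upper hx₂ hxy
    have hvy := antitoneOn_expRatio hx₂ (hx₂.trans_le hxy) hxy
    have e₂ := mul_le_mul_of_nonneg_left hvy
      (mul_nonneg (toddDeriv_pos hx₂).le (sub_nonneg.2 hxy))
    have e₃ := mul_le_mul_of_nonneg_right hvy (sub_nonneg.2 hm₂)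
    linarith
  · intro hpq
    have e₁ := mul_le_mul_of_nonneg_left (toddFun_sub_lower hx₁ hx)
      (mul_pos (add_pos hp hq) hv₂).le
    have e₂ := mul_nonneg (mul_nonneg (sub_nonneg.2 hpq) (sub_nonneg.2 hv))
      (mul_nonneg hs₂.le (sub_nonneg.2 hx))
    have e₃ : expRatio x₂ * toddDeriv x₂ * (x₂ - x₁) ≤
        expRatio x₂ * (toddFun x₂ - m) - expRatio x₁ * (toddFun x₁ - m) := by
      refine le_of_mul_le_mul_right ?_ hA
      rw [hdiff]
      linarith
    linarith
  · intro hqp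
    have hs₁ := mul_pos hv₁ (toddDeriv_pos hx₁)
    have e₁ := mul_le_mul_of_nonneg_left (toddFun_sub_upper hx₁ hx)
      (mul_pos (add_pos hp hq) hv₁).le
    have e₂ := mul_nonneg (mul_nonneg (sub_nonneg.2 hqp) (sub_nonneg.2 hv))
      (mul_nonneg hs₁.le (sub_nonneg.2 hx))
    have e₃ : expRatio x₂ * (toddFun x₂ - m) - expRatio x₁ * (toddFun x₁ - m) ≤
        expRatio x₁ * toddDeriv x₁ * (x₂ - x₁) := by
      refine le_of_mul_le_mul_right ?_ hA
      rw [hdiff]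
      linarith
    linarith

lemma expRatio_sum_le {p q x₁ x₂ y₁ y₂ : ℝ} (hp : 0 < p) (hq : 0 < q) (hx₁ : 0 < x₁)
    (hx : x₁ ≤ x₂) (hlo : min y₁ y₂ ≤ x₁) (hhi : x₂ ≤ max y₁ y₂) (hy₁ : 0 < y₁) (hy₂ : 0 < y₂)
    (hsum : p * y₁ + q * y₂ ≤ p * x₁ + q * x₂) :
    p * expRatio x₁ + q * expRatio x₂ ≤ p * expRatio y₁ + q * expRatio y₂ := by
  have := weighted_sum_le_of_antitoneOn_deriv (f := fun w => -expRatio w)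
    (f' := fun w => -(toddDeriv w - 1)) (fun w hw => (hasDerivAt_expRatio hw).neg)
    (fun x hx y hy h => by
      have := monotoneOn_toddDeriv hx hy h
      dsimp only
      linarith)
    (fun w hw => by linarith [toddDeriv_le_one hw]) hp.le hq.le hx₁ hx hlo hhi hy₁ hy₂ hsum
  linarith

lemma rpow_sum_le {α p q x₁ x₂ y₁ y₂ : ℝ} (hα : 0 < α) (hα1 : α ≤ 1) (hp : 0 < p) (hq : 0 < q)
    (hx₁ : 0 < x₁) (hx : x₁ ≤ x₂) (hlo : min y₁ y₂ ≤ x₁) (hhi : x₂ ≤ max y₁ y₂)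
    (hy₁ : 0 < y₁) (hy₂ : 0 < y₂) (hsum : p * y₁ + q * y₂ ≤ p * x₁ + q * x₂) :
    p * y₁ ^ α + q * y₂ ^ α ≤ p * x₁ ^ α + q * x₂ ^ α :=
  weighted_sum_le_of_antitoneOn_deriv (f := fun w => w ^ α) (f' := fun w => α * w ^ (α - 1))
    (fun w hw => hasDerivAt_rpow_const (Or.inl hw.ne'))
    (fun x hx y _ h => mul_le_mul_of_nonneg_left
      (rpow_le_rpow_of_nonpos hx h (by linarith)) hα.le)
    (fun w hw => by positivity) hp.le hq.le hx₁ hx hlo hhi hy₁ hy₂ hsum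

/-- `α⁻¹ (1 + t f'(t) / f(t)) - 1` for the density `f` of the multiple-outlier parallel system,
in terms of `wᵢ = (λᵢ t) ^ α`. -/
noncomputable def outlierScore (p q w₁ w₂ : ℝ) : ℝ :=
  p * expRatio w₁ + q * expRatio w₂ - toddMean p q w₁ w₂

lemma outlierScore_swap (p q w₁ w₂ : ℝ) : outlierScore p q w₁ w₂ = outlierScore q p w₂ w₁ := by
  simp only [outlierScore, toddMean]
  rw [add_comm (p * expRatio w₁), add_comm (p * (expRatio w₁ * _))]

lemma outlierScore_rpow_le {α p q x₁ x₂ y₁ y₂ : ℝ} (hα : 0 < α) (hα1 : α ≤ 1)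
    (hp : 0 < p) (hq : 0 < q) (hx₁ : 0 < x₁) (hx₂ : 0 < x₂) (hy₁ : 0 < y₁) (hy₂ : 0 < y₂)
    (hlo : min y₁ y₂ ≤ min x₁ x₂) (hhi : max x₁ x₂ ≤ max y₁ y₂)
    (hsum : p * y₁ + q * y₂ = p * x₁ + q * x₂) :
    outlierScore p q (x₁ ^ α) (x₂ ^ α) ≤ outlierScore p q (y₁ ^ α) (y₂ ^ α) := by
  wlog hx : x₁ ≤ x₂ generalizing p q x₁ x₂ y₁ y₂
  · rw [outlierScore_swap p q (x₁ ^ α), outlierScore_swap p q (y₁ ^ α)]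
    exact this hq hp hx₂ hx₁ hy₂ hy₁ (by rwa [min_comm y₂, min_comm x₂])
      (by rwa [max_comm y₂, max_comm x₂]) (by linarith) (le_of_not_ge hx)
  rw [min_eq_left hx] at hlo
  rw [max_eq_right hx] at hhi
  have hlo' : min (y₁ ^ α) (y₂ ^ α) ≤ x₁ ^ α := by
    rcases min_le_iff.1 hlo with h | h
    · exact min_le_of_left_le (rpow_le_rpow hy₁.le h hα.le)
    · exact min_le_of_right_le (rpow_le_rpow hy₂.le h hα.le)
  have hhi' : x₂ ^ α ≤ max (y₁ ^ α) (y₂ ^ α) := by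
    rcases le_max_iff.1 hhi with h | h
    · exact le_max_of_le_left (rpow_le_rpow hx₂.le h hα.le)
    · exact le_max_of_le_right (rpow_le_rpow hx₂.le h hα.le)
  have hsum' := rpow_sum_le hα hα1 hp hq hx₁ hx hlo hhi hy₁ hy₂ hsum.le
  have hx' := rpow_le_rpow hx₁.le hx hα.le
  have hx₁' := rpow_pos_of_pos hx₁ α
  have hy₁' := rpow_pos_of_pos hy₁ α
  have hy₂' := rpow_pos_of_pos hy₂ α
  exact sub_le_sub (expRatio_sum_le hp hq hx₁' hx' hlo' hhi' hy₁' hy₂' hsum')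
    (toddMean_le hp hq hx₁' hx' hlo' hhi' hy₁' hy₂' hsum')

/-- The logarithm of the density of the multiple-outlier parallel system, without the factor
`α / t`. -/
noncomputable def logDensity (α p q l₁ l₂ t : ℝ) : ℝ :=
  p * log (1 - exp (-((l₁ * t) ^ α))) + q * log (1 - exp (-((l₂ * t) ^ α))) +
    log (p * expRatio ((l₁ * t) ^ α) + q * expRatio ((l₂ * t) ^ α))

lemma hasDerivAt_mul_rpow {α l t : ℝ} (hl : 0 < l) (ht : 0 < t) :
    HasDerivAt (fun t => (l * t) ^ α) (α / t * (l * t) ^ α) t := by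
  have hlt := mul_pos hl ht
  refine (((hasDerivAt_id t).const_mul l).rpow_const (p := α)
    (Or.inl (by simpa using hlt.ne'))).congr_deriv ?_
  simp only [id, mul_one]
  rw [rpow_sub_one hlt.ne']
  field_simp

lemma one_sub_exp_neg_pos {w : ℝ} (hw : 0 < w) : 0 < 1 - exp (-w) := by
  rw [sub_pos, exp_lt_one_iff]
  exact neg_lt_zero.2 hw

lemma hasDerivAt_log_one_sub_exp_neg {w : ℝ} (hw : 0 < w) :
    HasDerivAt (fun w => log (1 - exp (-w))) (expRatio w / w) w := by
  have hE := (exp_sub_one_pos hw).ne'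
  refine ((((hasDerivAt_neg w).exp).const_sub 1).log (one_sub_exp_neg_pos hw).ne').congr_deriv ?_
  have h := (one_sub_exp_neg_pos hw).ne'
  rw [exp_neg] at h ⊢
  simp only [expRatio]
  have := (exp_pos w).ne'
  field_simp

lemma toddDeriv_sub_one {w : ℝ} (hw : 0 < w) :
    w * (toddDeriv w - 1) = expRatio w * (1 - toddFun w) := by
  have hE := (exp_sub_one_pos hw).ne'
  simp only [toddDeriv, toddFun, expRatio]
  field_simp
  ring

lemma hasDerivAt_logDensity {α p q l₁ l₂ t : ℝ} (hp : 0 < p) (hq : 0 < q) (hl₁ : 0 < l₁)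
    (hl₂ : 0 < l₂) (ht : 0 < t) :
    HasDerivAt (logDensity α p q l₁ l₂)
      (α / t * (1 + outlierScore p q ((l₁ * t) ^ α) ((l₂ * t) ^ α))) t := by
  have hw₁ := rpow_pos_of_pos (mul_pos hl₁ ht) α
  have hw₂ := rpow_pos_of_pos (mul_pos hl₂ ht) α
  have hd₁ := hasDerivAt_mul_rpow (α := α) hl₁ ht
  have hd₂ := hasDerivAt_mul_rpow (α := α) hl₂ ht
  have hA : 0 < p * expRatio ((l₁ * t) ^ α) + q * expRatio ((l₂ * t) ^ α) :=
    add_pos (mul_pos hp (expRatio_pos hw₁)) (mul_pos hq (expRatio_pos hw₂))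
  have g₁ := ((hasDerivAt_log_one_sub_exp_neg hw₁).comp t hd₁).const_mul p
  have g₂ := ((hasDerivAt_log_one_sub_exp_neg hw₂).comp t hd₂).const_mul q
  have g₃ := ((((hasDerivAt_expRatio hw₁).comp t hd₁).const_mul p).add
    (((hasDerivAt_expRatio hw₂).comp t hd₂).const_mul q)).log (by simpa using hA.ne')
  refine ((g₁.add g₂).add g₃).congr_deriv ?_
  have k₁ := toddDeriv_sub_one hw₁
  have k₂ := toddDeriv_sub_one hw₂
  simp only [outlierScore, toddMean, Function.comp, Pi.add_apply]
  set w₁ := (l₁ * t) ^ α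
  set w₂ := (l₂ * t) ^ α
  field_simp
  linear_combination α * p * k₁ + α * q * k₂

lemma exp_logDensity {α l₁ l₂ t : ℝ} {p q : ℕ} (hp : 0 < p) (hl₁ : 0 < l₁) (hl₂ : 0 < l₂)
    (ht : 0 < t) :
    exp (logDensity α p q l₁ l₂ t) =
      (1 - exp (-((l₁ * t) ^ α))) ^ p * (1 - exp (-((l₂ * t) ^ α))) ^ q *
        (p * expRatio ((l₁ * t) ^ α) + q * expRatio ((l₂ * t) ^ α)) := by
  have hw₁ := rpow_pos_of_pos (mul_pos hl₁ ht) α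
  have hw₂ := rpow_pos_of_pos (mul_pos hl₂ ht) α
  have hA : 0 < p * expRatio ((l₁ * t) ^ α) + q * expRatio ((l₂ * t) ^ α) :=
    add_pos_of_pos_of_nonneg (mul_pos (Nat.cast_pos.2 hp) (expRatio_pos hw₁))
      (mul_nonneg q.cast_nonneg (expRatio_pos hw₂).le)
  rw [logDensity, exp_add, exp_add, exp_nat_mul, exp_nat_mul, exp_log hA,
    exp_log (one_sub_exp_neg_pos hw₁), exp_log (one_sub_exp_neg_pos hw₂)]

lemma MajorizedBy.exists_le {n : ℕ} {x y : Fin n → ℝ} (h : MajorizedBy x y) (i : Fin n) :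
    ∃ j, y j ≤ x i := by
  obtain ⟨u, hu, hle⟩ := h.1 {i}
  obtain ⟨j, rfl⟩ := Finset.card_eq_one.1 (hu.trans (Finset.card_singleton i))
  exact ⟨j, by simpa using hle⟩

lemma MajorizedBy.exists_ge {n : ℕ} {x y : Fin n → ℝ} (h : MajorizedBy x y) (i : Fin n) :
    ∃ j, x i ≤ y j := by
  obtain ⟨u, hu, hle⟩ := h.1 {i}ᶜ
  have hc : uᶜ.card = 1 := by
    rw [Finset.card_compl, hu, ← Finset.card_compl, compl_compl, Finset.card_singleton]
  obtain ⟨j, hj⟩ := Finset.card_eq_one.1 hc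
  refine ⟨j, ?_⟩
  have e₁ := Finset.sum_add_sum_compl u y
  have e₂ := Finset.sum_add_sum_compl {i} x
  rw [hj, Finset.sum_singleton] at e₁
  rw [Finset.sum_singleton] at e₂
  linarith [h.2]

lemma sum_two_blocks (p q : ℕ) (a b : ℝ) :
    ∑ i : Fin (p + q), (if (i : ℕ) < p then a else b) = p * a + q * b := by
  simp [Fin.sum_univ_add]

/-- For `0 < α ≤ 1`, if the vector of `p` copies of `λ₁` followed by `q` copies of `λ₂`
is majorized by the vector of `p` copies of `θ₁` followed by `q` copies of `θ₂`
(`p + q = n`), then `X_{n:n}^λ ≤_lr X_{n:n}^θ`: the ratio of densities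
`f_{n:n}^θ(t) / f_{n:n}^λ(t)` of the multiple-outlier parallel Weibull systems,
with `f_{n:n}^λ(t) = (1 − e^{−(λ₁ t)^α})^p (1 − e^{−(λ₂ t)^α})^q · (α/t) ·
[p·u(λ₁ t) + q·u(λ₂ t)]` and `u(s) = s^α / (e^{s^α} − 1)`, is increasing in `t`
on `(0, ∞)`. -/
theorem multiple_outlier_weibull_lr_order_majorization
    (α lam₁ lam₂ θ₁ θ₂ : ℝ) (hα : 0 < α) (hα1 : α ≤ 1)
    (hlam₁ : 0 < lam₁) (hlam₂ : 0 < lam₂) (hθ₁ : 0 < θ₁) (hθ₂ : 0 < θ₂)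
    (p q n : ℕ) (hp : 0 < p) (hq : 0 < q) (hn : p + q = n)
    (hmaj : MajorizedBy (fun i : Fin n => if (i : ℕ) < p then lam₁ else lam₂)
      (fun i : Fin n => if (i : ℕ) < p then θ₁ else θ₂)) :
    MonotoneOn
      (fun t : ℝ =>
        ((1 - exp (-((θ₁ * t) ^ α))) ^ p * (1 - exp (-((θ₂ * t) ^ α))) ^ q *
            ((α / t) *
              ((p : ℝ) * ((θ₁ * t) ^ α / (exp ((θ₁ * t) ^ α) - 1)) +
                (q : ℝ) * ((θ₂ * t) ^ α / (exp ((θ₂ * t) ^ α) - 1))))) /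
          ((1 - exp (-((lam₁ * t) ^ α))) ^ p * (1 - exp (-((lam₂ * t) ^ α))) ^ q *
            ((α / t) *
              ((p : ℝ) * ((lam₁ * t) ^ α / (exp ((lam₁ * t) ^ α) - 1)) +
                (q : ℝ) * ((lam₂ * t) ^ α / (exp ((lam₂ * t) ^ α) - 1))))))
      (Ioi (0 : ℝ)) := by
  subst hn
  have hsum := hmaj.2
  rw [sum_two_blocks, sum_two_blocks] at hsum
  have hval : ∀ (a b : ℝ) (j : Fin (p + q)),
      min a b ≤ (if (j : ℕ) < p then a else b) ∧ (if (j : ℕ) < p then a else b) ≤ max a b := by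
    intro a b j
    split_ifs <;> simp
  have hmin : min θ₁ θ₂ ≤ min lam₁ lam₂ := by
    refine le_min ?_ ?_
    · obtain ⟨j, hj⟩ := hmaj.exists_le ⟨0, by lia⟩
      exact ((hval θ₁ θ₂ j).1.trans hj).trans_eq (if_pos hp)
    · obtain ⟨j, hj⟩ := hmaj.exists_le ⟨p, by lia⟩
      exact ((hval θ₁ θ₂ j).1.trans hj).trans_eq (if_neg (lt_irrefl p))
  have hmax : max lam₁ lam₂ ≤ max θ₁ θ₂ := by
    refine max_le ?_ ?_
    · obtain ⟨j, hj⟩ := hmaj.exists_ge ⟨0, by lia⟩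
      exact (if_pos hp).symm.trans_le (hj.trans (hval θ₁ θ₂ j).2)
    · obtain ⟨j, hj⟩ := hmaj.exists_ge ⟨p, by lia⟩
      exact (if_neg (lt_irrefl p)).symm.trans_le (hj.trans (hval θ₁ θ₂ j).2)
  have hp' : (0 : ℝ) < p := Nat.cast_pos.2 hp
  have hq' : (0 : ℝ) < q := Nat.cast_pos.2 hq
  have hmono : MonotoneOn
      (fun t => logDensity α p q θ₁ θ₂ t - logDensity α p q lam₁ lam₂ t) (Ioi 0) := by
    refine monotoneOn_Ioi_of_hasDerivAt (fun t ht =>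
      (hasDerivAt_logDensity hp' hq' hθ₁ hθ₂ ht).sub
        (hasDerivAt_logDensity hp' hq' hlam₁ hlam₂ ht)) fun t ht => ?_
    rw [← mul_sub]
    refine mul_nonneg (div_pos hα ht).le (sub_nonneg.2 (add_le_add_right ?_ 1))
    refine outlierScore_rpow_le hα hα1 hp' hq' (mul_pos hlam₁ ht) (mul_pos hlam₂ ht)
      (mul_pos hθ₁ ht) (mul_pos hθ₂ ht) ?_ ?_ (by linear_combination -t * hsum)
    · rw [← min_mul_of_nonneg _ _ ht.le, ← min_mul_of_nonneg _ _ ht.le]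
      exact mul_le_mul_of_nonneg_right hmin ht.le
    · rw [← max_mul_of_nonneg _ _ ht.le, ← max_mul_of_nonneg _ _ ht.le]
      exact mul_le_mul_of_nonneg_right hmax ht.le
  refine (exp_monotone.comp_monotoneOn hmono).congr fun t ht => ?_
  have ht' : α / t ≠ 0 := (div_pos hα ht).ne'
  simp only [Function.comp]
  rw [exp_sub, exp_logDensity hp hθ₁ hθ₂ ht, exp_logDensity hp hlam₁ hlam₂ ht]
  simp only [expRatio]
  rw [mul_left_comm _ (α / t), mul_left_comm _ (α / t), mul_div_mul_left _ _ ht']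
end

section
/- Fix a real α with 0 < α ≤ 1 and positive reals λ₁, λ₂, θ₁, θ₂ with θ₁ ≤ λ₁ ≤ λ₂ ≤ θ₂ and such that (λ₁, λ₂) is weakly majorized by (θ₁, θ₂), i.e., λ₁ + λ₂ ≥ θ₁ + θ₂ (the condition min(λ₁, λ₂) ≥ min(θ₁, θ₂) being automatic from θ₁ ≤ λ₁). Then the lifetime of the parallel system of two independent Weibull components with scale parameters (λ₁, λ₂) is smaller in the likelihood ratio order than that with scale parameters (θ₁, θ₂); that is, the ratio of densities f_{2:2}^θ(t) / f_{2:2}^λ(t) is increasing in t on (0, ∞). -/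
open Real Set

/-- The slope `(e ^ x - 1) / x` of the chord of the exponential over `[0, x]`. -/
noncomputable def expSlope (x : ℝ) : ℝ := (exp x - 1) / x

/-- The density, at time `s`, of the parallel system of two independent exponential components
with rates `a` and `b`. -/
noncomputable def parallelExpDensity (a b s : ℝ) : ℝ :=
  a * exp (-(a * s)) + b * exp (-(b * s)) - (a + b) * exp (-((a + b) * s))

/-- The negated logarithmic derivative, at time `1`, of `parallelExpDensity a b`. -/
noncomputable def parallelExpDecayRate (a b : ℝ) : ℝ :=
  a + b - (exp a + exp b) / (expSlope a + expSlope b)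

lemma expSlope_pos {x : ℝ} (hx : 0 < x) : 0 < expSlope x :=
  div_pos (by linarith [add_one_lt_exp hx.ne']) hx

lemma mul_expSlope {x : ℝ} (hx : 0 < x) : x * expSlope x = exp x - 1 := by
  rw [expSlope]; field_simp

lemma expSlope_eq_integral {x : ℝ} (hx : 0 < x) :
    expSlope x = ∫ y in (0 : ℝ)..1, exp (x * y) := by
  rw [intervalIntegral.integral_comp_mul_left (fun y => exp y) hx.ne', integral_exp, expSlope]
  simp [div_eq_inv_mul]

lemma expSlope_le_expSlope {a b : ℝ} (ha : 0 < a) (hab : a ≤ b) : expSlope a ≤ expSlope b := by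
  rw [expSlope_eq_integral ha, expSlope_eq_integral (ha.trans_le hab)]
  refine intervalIntegral.integral_mono_on zero_le_one
    (Continuous.intervalIntegrable (by fun_prop) _ _)
    (Continuous.intervalIntegrable (by fun_prop) _ _) fun x hx => ?_
  exact exp_le_exp.2 (mul_le_mul_of_nonneg_right hab hx.1)

lemma hasDerivAt_expSlope {x : ℝ} (hx : 0 < x) :
    HasDerivAt expSlope ((exp x - expSlope x) / x) x := by
  have h := ((Real.hasDerivAt_exp x).sub_const 1).div (hasDerivAt_id x) hx.ne'
  refine h.congr_deriv ?_
  simp only [expSlope, id]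
  field_simp

/-- Among pairs with a fixed sum, `exp a + exp b` grows faster than `exp (a x) + exp (b x)`
as the pair spreads out. -/
lemma exp_mul_add_mul_exp_add_le {a b a' b' x : ℝ} (h₁ : a ≤ a') (h₂ : a' ≤ b')
    (hsum : a + b = a' + b') (hx₀ : 0 ≤ x) (hx₁ : x ≤ 1) :
    (exp (a * x) + exp (b * x)) * (exp a' + exp b') ≤
      (exp (a' * x) + exp (b' * x)) * (exp a + exp b) := by
  obtain ⟨c, hc⟩ : ∃ c, c = (a + b) / 2 := ⟨_, rfl⟩
  obtain ⟨h, hh⟩ : ∃ h, h = (b - a) / 2 := ⟨_, rfl⟩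
  obtain ⟨k, hk⟩ : ∃ k, k = (b' - a') / 2 := ⟨_, rfl⟩
  have hsplit : ∀ r y : ℝ, exp ((c - r) * y) + exp ((c + r) * y) =
      2 * exp (c * y) * cosh (r * y) := by
    intro r y
    rw [cosh_eq, sub_mul, add_mul, sub_eq_add_neg, exp_add, exp_add]; ring
  have hcosh : cosh (h * x) * cosh k ≤ cosh (k * x) * cosh h := by
    have e : ∀ p q : ℝ, cosh p * cosh q = (cosh (p + q) + cosh (p - q)) / 2 := by
      intro p q; rw [cosh_add, cosh_sub]; ring
    have hk₀ : 0 ≤ k := by linarith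
    have hkh : k ≤ h := by linarith
    have hplus : cosh (h * x + k) ≤ cosh (k * x + h) := by
      rw [cosh_le_cosh, abs_of_nonneg (by nlinarith), abs_of_nonneg (by nlinarith)]
      nlinarith
    have hminus : cosh (h * x - k) ≤ cosh (k * x - h) := by
      rw [cosh_le_cosh, abs_of_nonpos (a := k * x - h) (by nlinarith), abs_le]
      constructor <;> nlinarith
    rw [e, e]; linarith
  have e₁ := hsplit h x
  have e₂ := hsplit k x
  have e₃ := hsplit h 1
  have e₄ := hsplit k 1
  rw [show c - h = a by linarith, show c + h = b by linarith] at e₁ e₃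
  rw [show c - k = a' by linarith, show c + k = b' by linarith] at e₂ e₄
  simp only [mul_one] at e₃ e₄
  rw [e₁, e₂, e₃, e₄]
  have := mul_le_mul_of_nonneg_left hcosh
    (mul_pos (mul_pos two_pos (exp_pos (c * x))) (mul_pos two_pos (exp_pos c))).le
  linarith

lemma parallelExpDecayRate_le_of_add_eq {a b a' b' : ℝ} (ha : 0 < a) (h₁ : a ≤ a')
    (h₂ : a' ≤ b') (hsum : a + b = a' + b') :
    parallelExpDecayRate a b ≤ parallelExpDecayRate a' b' := by
  have ha' : 0 < a' := ha.trans_le h₁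
  have hb' : 0 < b' := ha'.trans_le h₂
  have hb : 0 < b := by linarith
  have key : (expSlope a + expSlope b) * (exp a' + exp b') ≤
      (expSlope a' + expSlope b') * (exp a + exp b) := by
    have hint : ∀ r : ℝ, IntervalIntegrable (fun x => exp (r * x)) MeasureTheory.volume 0 1 :=
      fun r => Continuous.intervalIntegrable (by fun_prop) _ _
    rw [expSlope_eq_integral ha, expSlope_eq_integral hb, expSlope_eq_integral ha',
      expSlope_eq_integral hb', ← intervalIntegral.integral_add (hint a) (hint b),
      ← intervalIntegral.integral_add (hint a') (hint b'),
      ← intervalIntegral.integral_mul_const, ← intervalIntegral.integral_mul_const]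
    exact intervalIntegral.integral_mono_on zero_le_one
      (((hint a).add (hint b)).mul_const _) (((hint a').add (hint b')).mul_const _)
      fun x hx => exp_mul_add_mul_exp_add_le h₁ h₂ hsum hx.1 hx.2
  rw [parallelExpDecayRate, parallelExpDecayRate, hsum]
  refine sub_le_sub_left ?_ _
  rw [div_le_div_iff₀ (add_pos (expSlope_pos ha') (expSlope_pos hb'))
    (add_pos (expSlope_pos ha) (expSlope_pos hb))]
  linarith

lemma exp_mul_exp_sub_one_sub_le {a : ℝ} (ha : 0 ≤ a) :
    exp a * (exp a - 1 - a) ≤ 2 * (exp a - 1) ^ 2 := by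
  have h1 : exp a - 1 ≤ a * exp a := by
    have h := mul_le_mul_of_nonneg_left (add_one_le_exp (-a)) (exp_pos a).le
    rw [← exp_add, add_neg_cancel, exp_zero] at h
    linarith
  have h2 : 0 ≤ exp a - 1 := by linarith [add_one_le_exp a]
  nlinarith [sq_nonneg (exp a - 1)]

lemma expSlope_deriv_bound {a b : ℝ} (ha : 0 < a) (hab : a ≤ b) :
    exp a * (expSlope a + expSlope b) - (exp a + exp b) * ((exp a - expSlope a) / a) ≤
      (expSlope a + expSlope b) ^ 2 := by
  have hw := mul_expSlope ha
  have hW := mul_expSlope (ha.trans_le hab)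
  have hle := expSlope_le_expSlope ha hab
  have hpos := expSlope_pos ha
  have hbound := exp_mul_exp_sub_one_sub_le ha.le
  generalize expSlope a = w at *
  generalize expSlope b = W at *
  have hEa : exp a = 1 + a * w := by linarith
  have hEb : exp b = 1 + b * W := by linarith
  rw [hEa] at hbound
  rw [hEa, hEb]
  obtain ⟨d, hd⟩ : ∃ d, d = (1 + a * w - w) / a := ⟨_, rfl⟩
  have had : a * d = 1 + a * w - w := by rw [hd]; field_simp
  rw [← hd]
  have hd₀ : 0 ≤ d := by
    have h := mul_le_mul_of_nonneg_left (add_one_le_exp (-a)) (exp_pos a).le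
    rw [← exp_add, add_neg_cancel, exp_zero, hEa] at h
    have : 0 ≤ a * (1 + a * w - w) := by linarith
    rw [hd]
    exact div_nonneg (nonneg_of_mul_nonneg_right this ha) ha.le
  have hdiag : (1 + a * w) * (w - d) ≤ 2 * w ^ 2 := by
    have hwd : a * (w - d) = w - 1 := by linarith
    have : a ^ 2 * ((1 + a * w) * (w - d)) ≤ a ^ 2 * (2 * w ^ 2) := by
      have : a ^ 2 * ((1 + a * w) * (w - d)) = (1 + a * w) * (1 + a * w - 1 - a) := by
        linear_combination (1 + a * w) * a * hwd
      linarith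
    exact le_of_mul_le_mul_left this (by positivity)
  have hbW : a * d * W ≤ b * d * W := by gcongr; linarith
  have hsq : 0 ≤ (W - w) * (W + 2 * w) := mul_nonneg (by linarith) (by linarith)
  linear_combination hbW + hsq + 2 * hdiag - (W - w) * had

lemma parallelExpDecayRate_le_of_le {a a' b : ℝ} (ha : 0 < a) (h₁ : a ≤ a') (h₂ : a' ≤ b) :
    parallelExpDecayRate a b ≤ parallelExpDecayRate a' b := by
  have hderiv : ∀ x ∈ Icc a a', HasDerivAt (fun x => parallelExpDecayRate x b)
      (1 - (exp x * (expSlope x + expSlope b) -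
        (exp x + exp b) * ((exp x - expSlope x) / x)) / (expSlope x + expSlope b) ^ 2) x := by
    intro x hx
    have hx₀ : 0 < x := ha.trans_le hx.1
    have hb₀ : 0 < b := hx₀.trans_le (hx.2.trans h₂)
    exact ((hasDerivAt_id x).add_const b).sub
      (((Real.hasDerivAt_exp x).add_const (exp b)).div
        ((hasDerivAt_expSlope hx₀).add_const (expSlope b))
        (add_pos (expSlope_pos hx₀) (expSlope_pos hb₀)).ne')
  refine monotoneOn_of_hasDerivWithinAt_nonneg (convex_Icc a a')
    (fun x hx => (hderiv x hx).continuousAt.continuousWithinAt)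
    (fun x hx => (hderiv x (interior_subset hx)).hasDerivWithinAt) (fun x hx => ?_)
    (left_mem_Icc.2 h₁) (right_mem_Icc.2 h₁) h₁
  have hx := interior_subset hx
  have hx₀ : 0 < x := ha.trans_le hx.1
  have hxb : x ≤ b := hx.2.trans h₂
  have hpos := add_pos (expSlope_pos hx₀) (expSlope_pos (hx₀.trans_le hxb))
  rw [sub_nonneg, div_le_one (by positivity)]
  exact expSlope_deriv_bound hx₀ hxb

lemma parallelExpDecayRate_le {a₁ a₂ b₁ b₂ : ℝ} (ha : 0 < a₁) (h₂ : b₁ ≤ b₂)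
    (h₃ : b₂ ≤ a₂) (hsum : a₁ + a₂ ≤ b₁ + b₂) :
    parallelExpDecayRate a₁ a₂ ≤ parallelExpDecayRate b₁ b₂ :=
  (parallelExpDecayRate_le_of_le (a' := b₁ + b₂ - a₂) ha (by linarith) (by linarith)).trans
    (parallelExpDecayRate_le_of_add_eq (by linarith) (by linarith) h₂ (by ring))

lemma parallelExpDensity_eq (a b s : ℝ) :
    parallelExpDensity a b s = a * exp (-(a * s)) * (1 - exp (-(b * s))) +
      b * exp (-(b * s)) * (1 - exp (-(a * s))) := by
  rw [parallelExpDensity, add_mul a b s, neg_add, exp_add]; ring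

lemma parallelExpDensity_pos {a b s : ℝ} (ha : 0 < a) (hb : 0 < b) (hs : 0 < s) :
    0 < parallelExpDensity a b s := by
  have h : ∀ r : ℝ, 0 < r → 0 < 1 - exp (-(r * s)) := fun r hr =>
    sub_pos.2 (exp_lt_one_iff.2 (neg_lt_zero.2 (mul_pos hr hs)))
  have h₁ := h a ha
  have h₂ := h b hb
  rw [parallelExpDensity_eq]
  positivity

lemma hasDerivAt_parallelExpDensity {a b s : ℝ} (ha : 0 < a) (hb : 0 < b) (hs : 0 < s) :
    HasDerivAt (parallelExpDensity a b)
      (-(parallelExpDecayRate (a * s) (b * s) / s * parallelExpDensity a b s)) s := by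
  have hterm : ∀ r : ℝ, HasDerivAt (fun s => r * exp (-(r * s)))
      (r * (exp (-(r * s)) * -(r * 1))) s := fun r =>
    (((hasDerivAt_id s).const_mul r).neg.exp).const_mul r
  refine (((hterm a).add (hterm b)).sub (hterm (a + b))).congr_deriv ?_
  have hA := expSlope_pos (mul_pos ha hs)
  have hB := expSlope_pos (mul_pos hb hs)
  have hwA := mul_expSlope (mul_pos ha hs)
  have hwB := mul_expSlope (mul_pos hb hs)
  rw [parallelExpDensity, parallelExpDecayRate, add_mul a b s, neg_add, exp_add, exp_neg, exp_neg]
  generalize expSlope (a * s) = w at *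
  generalize expSlope (b * s) = W at *
  generalize exp (a * s) = x at *
  generalize exp (b * s) = y at *
  obtain rfl : x = 1 + a * s * w := by linarith
  obtain rfl : y = 1 + b * s * W := by linarith
  have : w + W ≠ 0 := by positivity
  field_simp
  ring

lemma monotoneOn_parallelExpDensity_div {a₁ a₂ b₁ b₂ : ℝ} (ha : 0 < a₁) (h₁ : a₁ ≤ b₁)
    (h₂ : b₁ ≤ b₂) (h₃ : b₂ ≤ a₂) (hsum : a₁ + a₂ ≤ b₁ + b₂) :
    MonotoneOn (fun s => parallelExpDensity a₁ a₂ s / parallelExpDensity b₁ b₂ s) (Ioi 0) := by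
  have hb₁ : 0 < b₁ := ha.trans_le h₁
  have hb₂ : 0 < b₂ := hb₁.trans_le h₂
  have ha₂ : 0 < a₂ := hb₂.trans_le h₃
  have hderiv := fun s (hs : s ∈ Ioi (0 : ℝ)) =>
    (hasDerivAt_parallelExpDensity ha ha₂ hs).div (hasDerivAt_parallelExpDensity hb₁ hb₂ hs)
      (parallelExpDensity_pos hb₁ hb₂ hs).ne'
  refine monotoneOn_of_hasDerivWithinAt_nonneg (convex_Ioi 0)
    (fun s hs => (hderiv s hs).continuousAt.continuousWithinAt)
    (fun s hs => (hderiv s (interior_subset hs)).hasDerivWithinAt) (fun s hs => ?_)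
  have hs : 0 < s := interior_subset hs
  have hrate := parallelExpDecayRate_le (mul_pos ha hs)
    (mul_le_mul_of_nonneg_right h₂ hs.le)
    (mul_le_mul_of_nonneg_right h₃ hs.le)
    (by linarith [mul_le_mul_of_nonneg_right hsum hs.le])
  have hN := parallelExpDensity_pos ha ha₂ hs
  have hD := parallelExpDensity_pos hb₁ hb₂ hs
  refine div_nonneg ?_ (sq_nonneg _)
  have := mul_nonneg (sub_nonneg.2 (div_le_div_of_nonneg_right hrate hs.le)) (mul_pos hN hD).le
  linear_combination this

/-- Concave increasing functions, here `x ↦ x ^ p`, preserve the order of sums under weak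
majorization of interlaced pairs. -/
lemma rpow_add_rpow_le_of_interlaced {p a₁ a₂ b₁ b₂ : ℝ} (hp : 0 ≤ p) (hp₁ : p ≤ 1)
    (ha : 0 ≤ a₁) (h₁ : a₁ ≤ b₁) (h₂ : b₁ ≤ b₂) (h₃ : b₂ ≤ a₂) (hsum : a₁ + a₂ ≤ b₁ + b₂) :
    a₁ ^ p + a₂ ^ p ≤ b₁ ^ p + b₂ ^ p := by
  obtain ⟨m, hm⟩ : ∃ m, m = b₁ + b₂ - a₂ := ⟨_, rfl⟩
  have ham : a₁ ^ p ≤ m ^ p := rpow_le_rpow ha (by linarith) hp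
  rcases (show m ≤ a₂ by linarith).eq_or_lt with h | h
  · obtain rfl : b₁ = m := by linarith
    obtain rfl : b₂ = a₂ := by linarith
    linarith
  have hd : 0 < a₂ - m := by linarith
  have hm₀ : m ∈ Ici (0 : ℝ) := mem_Ici.2 (by linarith)
  have ha₀ : a₂ ∈ Ici (0 : ℝ) := mem_Ici.2 (by linarith)
  obtain ⟨q, hq⟩ : ∃ q, q = (b₁ - m) / (a₂ - m) := ⟨_, rfl⟩
  have hq₀ : 0 ≤ q := hq ▸ div_nonneg (by linarith) hd.le
  have hq₁ : q ≤ 1 := hq ▸ (div_le_one hd).2 (by linarith)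
  have hqd : q * (a₂ - m) = b₁ - m := by rw [hq]; field_simp
  have c₁ := (concaveOn_rpow hp hp₁).2 hm₀ ha₀ (sub_nonneg.2 hq₁) hq₀ (by ring)
  have c₂ := (concaveOn_rpow hp hp₁).2 hm₀ ha₀ hq₀ (sub_nonneg.2 hq₁) (by ring)
  simp only [smul_eq_mul] at c₁ c₂
  rw [show (1 - q) * m + q * a₂ = b₁ by linarith] at c₁
  rw [show q * m + (1 - q) * a₂ = b₂ by linarith] at c₂
  linarith

lemma parallel_weibull_density_eq {α a b t : ℝ} (ha : 0 < a) (hb : 0 < b) (ht : 0 < t) :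
    (1 - exp (-((a * t) ^ α))) * (1 - exp (-((b * t) ^ α))) *
        ((α / t) * ((a * t) ^ α / (exp ((a * t) ^ α) - 1) +
          (b * t) ^ α / (exp ((b * t) ^ α) - 1))) =
      α / t * t ^ α * parallelExpDensity (a ^ α) (b ^ α) (t ^ α) := by
  rw [parallelExpDensity_eq, mul_rpow ha.le ht.le, mul_rpow hb.le ht.le]
  have hs := rpow_pos_of_pos ht α
  have hE : ∀ r : ℝ, 0 < r → exp (r ^ α * t ^ α) - 1 ≠ 0 := fun r hr =>
    (sub_pos.2 (one_lt_exp_iff.2 (mul_pos (rpow_pos_of_pos hr α) hs))).ne'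
  have hEa := hE a ha
  have hEb := hE b hb
  rw [exp_neg, exp_neg]
  have hEa₀ := exp_pos (a ^ α * t ^ α)
  have hEb₀ := exp_pos (b ^ α * t ^ α)
  generalize exp (a ^ α * t ^ α) = x at *
  generalize exp (b ^ α * t ^ α) = y at *
  field_simp

/-- For `0 < α ≤ 1`, if `θ₁ ≤ λ₁ ≤ λ₂ ≤ θ₂` and `(λ₁, λ₂) ≼^w (θ₁, θ₂)`
(i.e. `λ₁ + λ₂ ≥ θ₁ + θ₂`), then `X_{2:2}^λ ≤_lr X_{2:2}^θ`: the ratio of densities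
`f_{2:2}^θ(t) / f_{2:2}^λ(t)` of the parallel Weibull systems, where the density for
parameters `(a, b)` is `(1 − e^{−(a t)^α})(1 − e^{−(b t)^α}) · (α/t) · [u(a t) + u(b t)]`
with `u(s) = s^α / (e^{s^α} − 1)`, is increasing in `t` on `(0, ∞)`. -/
theorem parallel_weibull_lr_order_weak_maj_interlaced
    (α lam₁ lam₂ θ₁ θ₂ : ℝ) (hα : 0 < α) (hα1 : α ≤ 1)
    (hθ₁ : 0 < θ₁) (h₁ : θ₁ ≤ lam₁) (h₂ : lam₁ ≤ lam₂) (h₃ : lam₂ ≤ θ₂)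
    (hsum : θ₁ + θ₂ ≤ lam₁ + lam₂) :
    MonotoneOn
      (fun t : ℝ =>
        ((1 - exp (-((θ₁ * t) ^ α))) * (1 - exp (-((θ₂ * t) ^ α))) *
            ((α / t) *
              ((θ₁ * t) ^ α / (exp ((θ₁ * t) ^ α) - 1) +
                (θ₂ * t) ^ α / (exp ((θ₂ * t) ^ α) - 1)))) /
          ((1 - exp (-((lam₁ * t) ^ α))) * (1 - exp (-((lam₂ * t) ^ α))) *
            ((α / t) *
              ((lam₁ * t) ^ α / (exp ((lam₁ * t) ^ α) - 1) +
                (lam₂ * t) ^ α / (exp ((lam₂ * t) ^ α) - 1)))))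
      (Ioi (0 : ℝ)) := by
  have hlam₁ : 0 < lam₁ := hθ₁.trans_le h₁
  have hlam₂ : 0 < lam₂ := hlam₁.trans_le h₂
  have hθ₂ : 0 < θ₂ := hlam₂.trans_le h₃
  have hmono := monotoneOn_parallelExpDensity_div (rpow_pos_of_pos hθ₁ α)
    (rpow_le_rpow hθ₁.le h₁ hα.le) (rpow_le_rpow hlam₁.le h₂ hα.le)
    (rpow_le_rpow hlam₂.le h₃ hα.le)
    (rpow_add_rpow_le_of_interlaced hα.le hα1 hθ₁.le h₁ h₂ h₃ hsum)
  refine MonotoneOn.congr (f₁ := fun t => parallelExpDensity (θ₁ ^ α) (θ₂ ^ α) (t ^ α) /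
    parallelExpDensity (lam₁ ^ α) (lam₂ ^ α) (t ^ α)) (fun s hs t ht hst => ?_) fun t ht => ?_
  · exact hmono (rpow_pos_of_pos hs α) (rpow_pos_of_pos ht α)
      (rpow_le_rpow (le_of_lt hs) hst hα.le)
  · have ht₀ : 0 < t := ht
    have hc : α / t * t ^ α ≠ 0 := by positivity
    simp only [parallel_weibull_density_eq hθ₁ hθ₂ ht₀,
      parallel_weibull_density_eq hlam₁ hlam₂ ht₀]
    exact (mul_div_mul_left _ _ hc).symm
end
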